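/- Let T be a finite tree and suppose Player 1's first move in Trail Trap on T is u → v where v is not a central vertex of T. Then Player 2 has a winning strategy. Moreover, if T has two central vertices c and c' and Player 1's first move is neither c → c' nor c' → c, then Player 2 has a winning strategy. -/

import Mathlib

open SimpleGraph

/-- A valid partial play of Trail Trap: a list of moves (directed edges), where each
move is along an edge of `G`, no edge (as an unordered pair) is used twice, and each
player's moves form a trail (move `i+2` starts where move `i` ended). Moves at even
indices belong to Player 1 and moves at odd indices to Player 2. -/
def ValidPlay {V : Type*} (G : SimpleGraph V) (l : List (V × V)) : Prop :=
  (∀ m ∈ l, G.Adj m.1 m.2) ∧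
  (l.map (fun m => s(m.1, m.2))).Nodup ∧
  ∀ (i : ℕ) (h : i + 2 < l.length),
    (l.get ⟨i + 2, h⟩).1 = (l.get ⟨i, by omega⟩).2

/-- The play `l` follows strategy `σ` on all turns with index `≡ t (mod 2)`. -/
def FollowsAt {V : Type*} (σ : List (V × V) → V × V) (t : ℕ) (l : List (V × V)) : Prop :=
  ∀ (i : ℕ) (h : i < l.length), i % 2 = t → l.get ⟨i, h⟩ = σ (l.take i)

/-- Player 1 has a winning strategy in Trail Trap on `G`: a strategy `σ` for the
even-indexed moves such that every `σ`-consistent valid play that cannot be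
`σ`-consistently extended has odd length (i.e. Player 2 is the one stuck). -/
def P1Win {V : Type*} (G : SimpleGraph V) : Prop :=
  ∃ σ : List (V × V) → V × V, ∀ l : List (V × V),
    ValidPlay G l → FollowsAt σ 0 l →
    (∀ m : V × V, ¬ (ValidPlay G (l ++ [m]) ∧ FollowsAt σ 0 (l ++ [m]))) →
    l.length % 2 = 1

/-- Player 2 has a winning strategy in Trail Trap on `G`. -/
def P2Win {V : Type*} (G : SimpleGraph V) : Prop :=
  ∃ σ : List (V × V) → V × V, ∀ l : List (V × V),
    ValidPlay G l → FollowsAt σ 1 l →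
    (∀ m : V × V, ¬ (ValidPlay G (l ++ [m]) ∧ FollowsAt σ 1 (l ++ [m]))) →
    l.length % 2 = 0

/-- Player 1 has a winning strategy in Trail Trap on `G` whose first move is `u → v`. -/
def P1WinFrom {V : Type*} (G : SimpleGraph V) (u v : V) : Prop :=
  ∃ σ : List (V × V) → V × V, σ [] = (u, v) ∧ ∀ l : List (V × V),
    ValidPlay G l → FollowsAt σ 0 l →
    (∀ m : V × V, ¬ (ValidPlay G (l ++ [m]) ∧ FollowsAt σ 0 (l ++ [m]))) →
    l.length % 2 = 1

/-- Player 2 has a winning strategy in Trail Trap on `G`, given that Player 1's first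
move was `u → v`. -/
def P2WinAfter {V : Type*} (G : SimpleGraph V) (u v : V) : Prop :=
  ∃ σ : List (V × V) → V × V, ∀ l : List (V × V),
    l.head? = some (u, v) → ValidPlay G l → FollowsAt σ 1 l →
    (∀ m : V × V, ¬ (ValidPlay G (l ++ [m]) ∧ FollowsAt σ 1 (l ++ [m]))) →
    l.length % 2 = 0

/-- The eccentricity of a vertex: the maximum distance to any vertex. -/
noncomputable def eccOf {V : Type*} [Fintype V] (G : SimpleGraph V) (v : V) : ℕ :=
  Finset.univ.sup fun w => G.dist v w

/-- The radius of a graph: the minimum eccentricity. -/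
noncomputable def radOf {V : Type*} [Fintype V] (G : SimpleGraph V) : ℕ :=
  sInf (Set.range (eccOf G))

/-- The diameter of a graph: the maximum eccentricity. -/
noncomputable def diamOf {V : Type*} [Fintype V] (G : SimpleGraph V) : ℕ :=
  Finset.univ.sup (eccOf G)

/-- A central vertex: one whose eccentricity equals the radius. -/
def IsCentral {V : Type*} [Fintype V] (G : SimpleGraph V) (v : V) : Prop :=
  eccOf G v = radOf G

/-- Every vertex on a geodesic from `x` to `W` is closer to `W` than to `v`, if `x` is. -/
lemma tt_side_of_geodesic {V : Type*} {T : SimpleGraph V} (hT : T.IsTree) {v W x z : V}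
    (hvW : T.Adj v W) (hx : T.dist v x = T.dist W x + 1)
    (p : T.Walk x W) (hp : p.length = T.dist x W) (hz : z ∈ p.support) :
    T.dist v z = T.dist W z + 1 := by
  obtain ⟨q, r, rfl⟩ := SimpleGraph.Walk.mem_support_iff_exists_append.mp hz
  rw [SimpleGraph.Walk.length_append] at hp
  have h1 := SimpleGraph.dist_le q
  have h2 := SimpleGraph.dist_le r
  have h3 := hT.connected.dist_triangle (u := v) (v := z) (w := x)
  have h4 := hT.dist_eq_dist_add_one_of_adj z hvW
  simp only [T.dist_comm (v := v), T.dist_comm (v := W), T.dist_comm (u := z)] at *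
  have e1 := T.dist_comm (u := x) (v := z)
  have e2 := T.dist_comm (u := x) (v := W)
  have e3 := T.dist_comm (u := x) (v := v)
  have e4 := T.dist_comm (u := z) (v := v)
  have e5 := T.dist_comm (u := z) (v := W)
  omega

/-- Distance across an edge of a tree. -/
lemma tt_cross {V : Type*} {T : SimpleGraph V} (hT : T.IsTree) {v W x y : V}
    (hvW : T.Adj v W) (hx : T.dist v x = T.dist W x + 1)
    (hy : T.dist W y = T.dist v y + 1) :
    T.dist x y = T.dist W x + 1 + T.dist v y := by
  obtain ⟨p, hp, hpl⟩ := hT.connected.exists_path_of_dist x W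
  obtain ⟨q, hq, hql⟩ := hT.connected.exists_path_of_dist v y
  have hpath : (p.append (SimpleGraph.Walk.cons hvW.symm q)).IsPath := by
    rw [SimpleGraph.Walk.isPath_def, SimpleGraph.Walk.support_append]
    simp only [SimpleGraph.Walk.support_cons, List.tail_cons]
    rw [List.nodup_append]
    refine ⟨hp.support_nodup, hq.support_nodup, ?_⟩
    rintro a ha b hb rfl
    have h1 := tt_side_of_geodesic hT hvW hx p hpl ha
    have h2 := tt_side_of_geodesic hT hvW.symm hy q.reverse
      (by rw [SimpleGraph.Walk.length_reverse, hql, T.dist_comm]) (z := a) (by simpa using hb)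
    omega
  obtain ⟨r, hr, hrl⟩ := hT.connected.exists_path_of_dist x y
  have := (hT.isAcyclic.subsingleton_path x y).elim ⟨_, hpath⟩ ⟨r, hr⟩
  have h3 : p.append (SimpleGraph.Walk.cons hvW.symm q) = r := congrArg Subtype.val this
  have h4 := congrArg SimpleGraph.Walk.length h3
  rw [SimpleGraph.Walk.length_append, SimpleGraph.Walk.length_cons] at h4
  have e2 := T.dist_comm (u := x) (v := W)
  omega

lemma tt_sides {V : Type*} {T : SimpleGraph V} (hT : T.IsTree) {v W : V}
    (hvW : T.Adj v W) (y : V) :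
    T.dist v y = T.dist W y + 1 ∨ T.dist W y = T.dist v y + 1 := by
  have h4 := hT.dist_eq_dist_add_one_of_adj y hvW
  rwa [T.dist_comm (u := y) (v := v), T.dist_comm (u := y) (v := W)] at h4

/-- An edge crossing the cut of `vW` is `vW`. -/
lemma tt_cross_edge {V : Type*} {T : SimpleGraph V} (hT : T.IsTree) {v W x y : V}
    (hvW : T.Adj v W) (hx : T.dist v x = T.dist W x + 1)
    (hy : T.dist W y = T.dist v y + 1) (hxy : T.Adj x y) : x = W ∧ y = v := by
  have h := tt_cross hT hvW hx hy
  rw [SimpleGraph.dist_eq_one_iff_adj.mpr hxy] at h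
  have h1 : T.dist W x = 0 := by omega
  have h2 : T.dist v y = 0 := by omega
  rw [hT.connected.dist_eq_zero_iff] at h1 h2
  exact ⟨h1.symm, h2.symm⟩

/-- The neighbour closer to `v` is unique. -/
lemma tt_parent_unique {V : Type*} {T : SimpleGraph V} (hT : T.IsTree) {v y p q : V}
    (hp : T.Adj y p) (hq : T.Adj y q) (hvp : T.dist v y = T.dist v p + 1)
    (hvq : T.dist v y = T.dist v q + 1) : p = q := by
  have e1 := T.dist_comm (u := v) (v := p)
  have e2 := T.dist_comm (u := v) (v := y)
  have e3 := T.dist_comm (u := v) (v := q)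
  have hyq := SimpleGraph.dist_eq_one_iff_adj.mpr hq
  rcases tt_sides hT hp q with h | h
  · have : T.dist p q = 0 := by omega
    exact hT.connected.dist_eq_zero_iff.mp this
  · have := tt_cross hT hp (x := v) (y := q) (by omega) h
    omega

/-- Existence of a neighbour closer to a target. -/
lemma tt_toward {V : Type*} {T : SimpleGraph V} (hT : T.IsTree) {v x : V} (hne : v ≠ x) :
    ∃ w, T.Adj v w ∧ T.dist v x = T.dist w x + 1 := by
  obtain ⟨p, hp⟩ := hT.connected.exists_walk_length_eq_dist v x
  cases p with
  | nil => exact absurd rfl hne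
  | cons h q =>
    refine ⟨_, h, ?_⟩
    rw [SimpleGraph.Walk.length_cons] at hp
    have h1 := SimpleGraph.dist_le q
    have h2 := tt_sides hT h x
    omega

/-- Geodesic sequences. -/
lemma tt_geodesic {V : Type*} {T : SimpleGraph V} (hT : T.IsTree) (W x : V) :
    ∃ b : ℕ → V, b 0 = W ∧ (∀ i < T.dist W x, T.Adj (b i) (b (i + 1))) ∧
      ∀ i ≤ T.dist W x, T.dist (b i) x + i = T.dist W x := by
  have key : ∀ n (W : V), T.dist W x = n → ∃ b : ℕ → V, b 0 = W ∧
      (∀ i < n, T.Adj (b i) (b (i + 1))) ∧ ∀ i ≤ n, T.dist (b i) x + i = n := by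
    intro n
    induction n with
    | zero =>
      intro W h
      exact ⟨fun _ => W, rfl, fun i hi => by omega, fun i hi => by simp only; omega⟩
    | succ n ih =>
      intro W h
      have hne : W ≠ x := by
        rintro rfl
        simp at h
      obtain ⟨w, hw, hd⟩ := tt_toward hT hne
      obtain ⟨b, hb0, hb1, hb2⟩ := ih w (by omega)
      refine ⟨fun i => Nat.casesOn i W b, rfl, ?_, ?_⟩
      · rintro (_ | i) hi
        · simpa [hb0] using hw
        · exact hb1 i (by omega)
      · rintro (_ | i) hi
        · simpa using h
        · have := hb2 i (by omega)
          simp only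
          omega
  exact key _ W rfl

/-- The game lemma: Player 2 follows a fixed path inside the far side of the edge `vW`. -/
lemma tt_game {V : Type*} {T : SimpleGraph V} (hT : T.IsTree) {u v W : V}
    (huv : T.Adj u v) (hvW : T.Adj v W) (a : ℕ → V) (n : ℕ)
    (ha : ∀ i < n, T.Adj (a i) (a (i + 1)))
    (hside : ∀ i < n, T.dist v (a (i + 1)) = T.dist W (a (i + 1)) + 1)
    (hinj : ∀ i k, i < k → k < n → s(a i, a (i + 1)) ≠ s(a k, a (k + 1)))
    (hne : ∀ k < n, s(u, v) ≠ s(a k, a (k + 1)))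
    (hblock : s(u, v) = s(v, W) ∨ s(a 0, a 1) = s(v, W))
    (hdepth : ∀ y, T.dist W y = T.dist v y + 1 → T.dist v y < n) :
    P2WinAfter T u v := by
  refine ⟨fun l => (a (l.length / 2), a (l.length / 2 + 1)), ?_⟩
  intro l hhead hval hfol hmax
  by_contra hodd
  obtain ⟨k, hk⟩ : ∃ k, l.length = 2 * k + 1 := ⟨l.length / 2, by omega⟩
  obtain ⟨hadj, hnd, htr⟩ := hval
  have h0 : l[0]'(by omega) = (u, v) := by
    cases l with
    | nil => simp at hhead
    | cons b t => simpa using hhead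
  have hP2 : ∀ i (h : 2 * i + 1 < l.length), l[2 * i + 1] = (a i, a (i + 1)) := by
    intro i h
    have := hfol (2 * i + 1) h (by omega)
    simp only [List.get_eq_getElem, List.length_take] at this
    have e : min (2 * i + 1) l.length / 2 = i := by omega
    rw [this, e]
  have hdist : ∀ i j (hij : i < j) (hj : j < l.length),
      s((l[i]'(by omega)).1, (l[i]'(by omega)).2) ≠ s(l[j].1, l[j].2) := by
    intro i j hij hj he
    rw [List.Nodup, List.pairwise_iff_getElem] at hnd
    have := hnd i j (by simp; omega) (by simpa using hj) hij
    simp only [List.getElem_map] at this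
    exact this he
  have htr' : ∀ i (h : i + 2 < l.length), l[i + 2].1 = (l[i]'(by omega)).2 := by
    intro i h
    simpa using htr i h
  have hvside : T.dist W v = T.dist v v + 1 := by
    rw [SimpleGraph.dist_self, SimpleGraph.dist_eq_one_iff_adj.mpr hvW.symm]
  -- invariant for Player 1
  have hP1 : ∀ j (h : 2 * j < l.length),
      T.dist v l[2 * j].2 = j ∧ T.dist W l[2 * j].2 = T.dist v l[2 * j].2 + 1 ∧
      (0 < j → T.dist v l[2 * j].1 + 1 = j ∧ T.dist W l[2 * j].1 = T.dist v l[2 * j].1 + 1) := by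
    intro j
    induction j with
    | zero =>
      intro h
      simp only [Nat.mul_zero, h0]
      exact ⟨SimpleGraph.dist_self, hvside, fun h => by omega⟩
    | succ j ih =>
      intro h
      obtain ⟨i1, i2, i3⟩ := ih (by omega)
      have hA : T.Adj (l[2 * (j + 1)]).1 (l[2 * (j + 1)]).2 := hadj _ (List.getElem_mem _)
      have hB : T.Adj (l[2 * j]'(by omega)).1 (l[2 * j]'(by omega)).2 :=
        hadj _ (List.getElem_mem _)
      have hst : (l[2 * (j + 1)]).1 = (l[2 * j]'(by omega)).2 := htr' (2 * j) h
      have hd1 := hdist (2 * j) (2 * (j + 1)) (by omega) h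
      have hd0 := hdist 0 (2 * (j + 1)) (by omega) h
      have hd2 := hdist 1 (2 * (j + 1)) (by omega) h
      have hp0 := hP2 0 (by omega)
      simp only [Nat.mul_zero, Nat.zero_add] at hp0
      rw [hp0] at hd2
      rw [h0] at hd0
      rw [hst] at hA hd0 hd1 hd2 ⊢
      have hz2 : T.dist W (l[2 * (j + 1)]).2 = T.dist v (l[2 * (j + 1)]).2 + 1 := by
        rcases tt_sides hT hvW (l[2 * (j + 1)]).2 with hz | hz
        · obtain ⟨e1, e2⟩ := tt_cross_edge hT hvW hz i2 hA.symm
          rw [e1, e2] at hd0 hd2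
          rcases hblock with hb | hb
          · exact absurd hb hd0
          · exact absurd hb hd2
        · exact hz
      refine ⟨?_, hz2, fun _ => ⟨by omega, i2⟩⟩
      rcases hT.dist_eq_dist_add_one_of_adj v hA with hz | hz
      · exfalso
        obtain ⟨k1, k2⟩ := i3 (by omega)
        have := tt_parent_unique hT hA hB.symm hz (by omega)
        exact hd1 (by rw [this]; exact Sym2.eq_swap)
      · omega
  have hkn : k < n := by
    obtain ⟨q1, q2, -⟩ := hP1 k (by omega)
    have := hdepth _ q2
    omega
  apply hmax (a k, a (k + 1))
  refine ⟨⟨?_, ?_, ?_⟩, ?_⟩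
  · intro m hm
    rcases List.mem_append.mp hm with hm | hm
    · exact hadj m hm
    · rw [List.mem_singleton] at hm
      subst hm
      exact ha k hkn
  · rw [List.map_append, List.nodup_append]
    refine ⟨hnd, by simp, ?_⟩
    rintro e he f hf rfl
    simp only [List.map_cons, List.map_nil, List.mem_singleton] at hf
    subst hf
    obtain ⟨m, hm, hme⟩ := List.mem_map.mp he
    obtain ⟨i, hi, rfl⟩ := List.getElem_of_mem hm
    rcases Nat.even_or_odd' i with ⟨j, rfl | rfl⟩
    · rcases Nat.eq_zero_or_pos j with rfl | hj
      · simp only [Nat.mul_zero, h0] at hme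
        exact hne k hkn hme
      · obtain ⟨-, q2, q3⟩ := hP1 j hi
        obtain ⟨-, q4⟩ := q3 hj
        have q5 := hside k hkn
        rcases Sym2.eq_iff.mp hme with ⟨r1, r2⟩ | ⟨r1, r2⟩
        · rw [r2] at q2; omega
        · rw [r1] at q4; omega
    · rw [hP2 j hi] at hme
      exact hinj j k (by omega) hkn hme
  · intro i h
    simp only [List.get_eq_getElem]
    rw [List.length_append, List.length_singleton] at h
    by_cases hi : i + 2 < l.length
    · rw [List.getElem_append_left hi, List.getElem_append_left (by omega)]
      exact htr' i hi
    · rw [List.getElem_append_right (by omega), List.getElem_append_left (by omega)]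
      simp only [List.getElem_singleton]
      obtain ⟨j, rfl⟩ : ∃ j, k = j + 1 := ⟨k - 1, by omega⟩
      have : i = 2 * j + 1 := by omega
      subst this
      rw [hP2 j (by omega)]
  · intro i h hi
    rw [List.length_append, List.length_singleton] at h
    simp only [List.get_eq_getElem]
    by_cases hi' : i < l.length
    · rw [List.getElem_append_left hi', List.take_append_of_le_length (by omega)]
      simpa using hfol i hi' hi
    · have : i = l.length := by omega
      subst this
      have e : l.length / 2 = k := by omega
      simp [e]

lemma tt_dist_le_ecc {V : Type*} [Fintype V] (T : SimpleGraph V) (v w : V) :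
    T.dist v w ≤ eccOf T v :=
  Finset.le_sup (f := fun w => T.dist v w) (Finset.mem_univ w)

lemma tt_exists_ecc {V : Type*} [Fintype V] (T : SimpleGraph V) (v : V) :
    ∃ x, T.dist v x = eccOf T v := by
  obtain ⟨x, -, hx⟩ := Finset.exists_mem_eq_sup (s := (Finset.univ : Finset V))
    ⟨v, Finset.mem_univ v⟩ (fun w => T.dist v w)
  exact ⟨x, hx.symm⟩

/-- A geodesic from `W` to `x` stays on the side of `W`; its edges are distinct. -/
lemma tt_geodesic_side {V : Type*} {T : SimpleGraph V} (hT : T.IsTree) {v W x : V}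
    (hvW : T.Adj v W) (hx : T.dist v x = T.dist W x + 1) (b : ℕ → V) (hb0 : b 0 = W)
    (hb1 : ∀ i < T.dist W x, T.Adj (b i) (b (i + 1)))
    (hb2 : ∀ i ≤ T.dist W x, T.dist (b i) x + i = T.dist W x) :
    ∀ i ≤ T.dist W x, T.dist v (b i) = T.dist W (b i) + 1 := by
  have hle : ∀ i ≤ T.dist W x, T.dist W (b i) ≤ i := by
    intro i
    induction i with
    | zero => intro _; simp [hb0]
    | succ i ih =>
      intro hi
      have h1 := ih (by omega)
      have h2 := hT.connected.dist_triangle (u := W) (v := b i) (w := b (i + 1))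
      have h3 := SimpleGraph.dist_eq_one_iff_adj.mpr (hb1 i (by omega))
      omega
  intro i hi
  have h1 := hle i hi
  have h2 := hb2 i hi
  have h3 := hT.connected.dist_triangle (u := v) (v := b i) (w := x)
  have h4 := tt_sides hT hvW (b i)
  omega

lemma tt_edge_ne {V : Type*} {T : SimpleGraph V} {x p q r s : V}
    (h : T.dist p x + T.dist q x ≠ T.dist r x + T.dist s x) : s(p, q) ≠ s(r, s) := by
  intro he
  rcases Sym2.eq_iff.mp he with ⟨rfl, rfl⟩ | ⟨rfl, rfl⟩
  · exact h rfl
  · exact h (by omega)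

/-- Player 2 plays `v → w`. -/
lemma tt_caseA {V : Type*} [Fintype V] {T : SimpleGraph V} (hT : T.IsTree) {u v w : V}
    (huv : T.Adj u v) (hvw : T.Adj v w) (hwu : w ≠ u) (hecc : eccOf T w ≤ eccOf T v) :
    P2WinAfter T u v := by
  obtain ⟨x, hx⟩ := tt_exists_ecc T v
  have hwx := tt_dist_le_ecc T w x
  have hd : T.dist v x = T.dist w x + 1 := by
    have := tt_sides hT hvw x
    omega
  obtain ⟨b, hb0, hb1, hb2⟩ := tt_geodesic hT w x
  have hs := tt_geodesic_side hT hvw hd b hb0 hb1 hb2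
  have huside : T.dist w u = T.dist v u + 1 := by
    rcases tt_sides hT hvw u with h | h
    · exfalso
      have := SimpleGraph.dist_eq_one_iff_adj.mpr huv.symm
      have h0 : T.dist w u = 0 := by omega
      exact hwu (hT.connected.dist_eq_zero_iff.mp h0)
    · exact h
  have hvside : T.dist w v = T.dist v v + 1 := by
    rw [SimpleGraph.dist_self, SimpleGraph.dist_eq_one_iff_adj.mpr hvw.symm]
  let a : ℕ → V := fun i => Nat.casesOn i v b
  have ha2 : ∀ i ≤ T.dist w x + 1, T.dist (a i) x + i = T.dist w x + 1 := by
    rintro (_ | i) hi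
    · simpa [a] using hd
    · have := hb2 i (by omega)
      simp only [a]
      omega
  refine tt_game hT huv hvw a (T.dist w x + 1) ?_ ?_ ?_ ?_ ?_ ?_
  · rintro (_ | i) hi
    · simpa [a, hb0] using hvw
    · exact hb1 i (by omega)
  · intro i hi
    exact hs i (by omega)
  · intro i k hik hk
    apply tt_edge_ne (T := T) (x := x)
    have := ha2 i (by omega)
    have := ha2 (i + 1) (by omega)
    have := ha2 k (by omega)
    have := ha2 (k + 1) (by omega)
    omega
  · intro k hk he
    have h1 : T.dist v (a (k + 1)) = T.dist w (a (k + 1)) + 1 := hs k (by omega)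
    rcases Sym2.eq_iff.mp he with ⟨r1, r2⟩ | ⟨r1, r2⟩
    · rw [← r2] at h1; omega
    · rw [← r1] at h1; omega
  · right
    simp [a, hb0]
  · intro y hy
    have := tt_dist_le_ecc T w y
    omega

/-- Player 2 starts at `u` and moves away from `v`. -/
lemma tt_caseB {V : Type*} [Fintype V] {T : SimpleGraph V} (hT : T.IsTree) {u v : V}
    (huv : T.Adj u v) (hecc : eccOf T u < eccOf T v) :
    P2WinAfter T u v := by
  obtain ⟨x, hx⟩ := tt_exists_ecc T v
  have hwx := tt_dist_le_ecc T u x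
  have hd : T.dist v x = T.dist u x + 1 := by
    have := tt_sides hT huv.symm x
    omega
  obtain ⟨b, hb0, hb1, hb2⟩ := tt_geodesic hT u x
  have hs := tt_geodesic_side hT huv.symm hd b hb0 hb1 hb2
  have hvside : T.dist u v = T.dist v v + 1 := by
    rw [SimpleGraph.dist_self, SimpleGraph.dist_eq_one_iff_adj.mpr huv]
  refine tt_game hT huv huv.symm b (T.dist u x) hb1 ?_ ?_ ?_ (Or.inl Sym2.eq_swap) ?_
  · intro i hi
    exact hs (i + 1) (by omega)
  · intro i k hik hk
    apply tt_edge_ne (T := T) (x := x)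
    have := hb2 i (by omega)
    have := hb2 (i + 1) (by omega)
    have := hb2 k (by omega)
    have := hb2 (k + 1) (by omega)
    omega
  · intro k hk he
    have h1 := hs k (by omega)
    have h2 := hs (k + 1) (by omega)
    rcases Sym2.eq_iff.mp he with ⟨r1, r2⟩ | ⟨r1, r2⟩
    · rw [← r2] at h2; omega
    · rw [← r2] at h1; omega
  · intro y hy
    have := tt_dist_le_ecc T u y
    omega

lemma tt_rad_le {V : Type*} [Fintype V] (T : SimpleGraph V) (v : V) :
    radOf T ≤ eccOf T v := Nat.sInf_le ⟨v, rfl⟩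

/-- A non-central vertex has a neighbour of smaller eccentricity. -/
lemma tt_descend {V : Type*} [Fintype V] {T : SimpleGraph V} (hT : T.IsTree) {v : V}
    (hv : ¬ IsCentral T v) : ∃ w, T.Adj v w ∧ eccOf T w < eccOf T v := by
  obtain ⟨c, hc⟩ : radOf T ∈ Set.range (eccOf T) := Nat.sInf_mem ⟨_, v, rfl⟩
  have hlt : radOf T < eccOf T v := lt_of_le_of_ne (tt_rad_le T v) (fun h => hv h.symm)
  obtain ⟨x, hx⟩ := tt_exists_ecc T v
  have hne : v ≠ x := by
    rintro rfl
    rw [SimpleGraph.dist_self] at hx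
    omega
  obtain ⟨w, hw, hd⟩ := tt_toward hT hne
  refine ⟨w, hw, ?_⟩
  by_contra hcon
  obtain ⟨y, hy⟩ := tt_exists_ecc T w
  have h1 := tt_dist_le_ecc T v y
  rcases tt_sides hT hw y with h | h
  · omega
  · have h2 := tt_cross hT hw hd h
    have h3 := tt_dist_le_ecc T c x
    have h4 := tt_dist_le_ecc T c y
    have h5 := hT.connected.dist_triangle (u := x) (v := c) (w := y)
    have e := T.dist_comm (u := x) (v := c)
    omega

lemma tt_noncentral {V : Type*} [Fintype V] {T : SimpleGraph V} (hT : T.IsTree) {u v : V}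
    (huv : T.Adj u v) (hv : ¬ IsCentral T v) : P2WinAfter T u v := by
  obtain ⟨w, hw, hlt⟩ := tt_descend hT hv
  by_cases hwu : w = u
  · subst hwu
    exact tt_caseB hT huv hlt
  · exact tt_caseA hT huv hw hwu hlt.le

lemma tt_bicentral {V : Type*} [Fintype V] {T : SimpleGraph V} (hT : T.IsTree) {u v c' : V}
    (huv : T.Adj u v) (hne : v ≠ c') (hset : {w | IsCentral T w} = {v, c'}) (hu : u ≠ c') :
    P2WinAfter T u v := by
  have hv : eccOf T v = radOf T := by
    have : v ∈ {w | IsCentral T w} := by rw [hset]; simp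
    exact this
  have hc : eccOf T c' = radOf T := by
    have : c' ∈ {w | IsCentral T w} := by rw [hset]; simp
    exact this
  obtain ⟨w, hw, hd⟩ := tt_toward hT hne
  have hecc : eccOf T w ≤ eccOf T v := by
    by_contra hcon
    obtain ⟨y, hy⟩ := tt_exists_ecc T w
    have h1 := tt_dist_le_ecc T v y
    rcases tt_sides hT hw y with h | h
    · omega
    · have h2 := tt_cross hT hw hd h
      have h3 := tt_dist_le_ecc T c' y
      omega
  have hwc : w ∈ {w | IsCentral T w} := le_antisymm (hecc.trans hv.le) (tt_rad_le T w)
  rw [hset] at hwc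
  rcases hwc with h | h
  · exact absurd h hw.ne'
  · have h : w = c' := h
    exact tt_caseA hT huv hw (by rw [h]; exact hu.symm) hecc

/-- On a finite tree `T`, if Player 1's first move is `u → v` with `v` not a central
vertex, then Player 2 wins; and if `T` has exactly two central vertices `c, c'` and
Player 1's first move is neither `c → c'` nor `c' → c`, then Player 2 wins. -/
theorem stmt_14 {V : Type*} [Fintype V] (T : SimpleGraph V) (hT : T.IsTree)
    (u v : V) (huv : T.Adj u v) :
    (¬ IsCentral T v → P2WinAfter T u v) ∧
    (∀ c c' : V, c ≠ c' → {w | IsCentral T w} = {c, c'} →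
      (u, v) ≠ (c, c') → (u, v) ≠ (c', c) → P2WinAfter T u v) := by
  refine ⟨tt_noncentral hT huv, ?_⟩
  intro c c' hne hset h1 h2
  by_cases hv : IsCentral T v
  · have hmem : v ∈ {w | IsCentral T w} := hv
    rw [hset] at hmem
    rcases hmem with h | h
    · have h : v = c := h
      subst h
      exact tt_bicentral hT huv hne hset (fun e => h2 (by rw [e]))
    · have h : v = c' := h
      subst h
      exact tt_bicentral hT huv hne.symm (by rw [hset, Set.pair_comm])
        (fun e => h1 (by rw [e]))
  · exact tt_noncentral hT huv hv
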